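/- Under the setup of the previous statement (standard normal ρ_X on ℝ^n, f continuously differentiable with ρ_X-square-integrable gradient, C = ∫ ∇f ∇fᵀ ρ_X dx = W Λ Wᵀ with eigenvalues λ₁ ≥ ⋯ ≥ λ_n ≥ 0, W₁ the first k eigenvectors, g the conditional expectation of f over the inactive variable, f_g(x) = g(W₁ᵀx), and g_N the N-sample Monte Carlo approximation with i.i.d. samples Z_j^y ∼ φ_{n−k} jointly measurable in (y,ω)), it holds that E[ ∫_{ℝ^n} (f_g(x) − f_{g_N}(x,·))² ρ_X(x) dx ] ≤ (1/N)(λ_{k+1} + ⋯ + λ_n), where f_{g_N}(x,ω) := g_N(W₁ᵀx, ω). -/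

import Mathlib

open MeasureTheory Matrix Set ProbabilityTheory

/-- The standard normal density on `ℝ^n`. -/
noncomputable def gaussDensity (n : ℕ) (x : Fin n → ℝ) : ℝ :=
  (2 * Real.pi) ^ (-(n : ℝ) / 2) * Real.exp (-(∑ i, x i ^ 2) / 2)

/-- The vector of partial derivatives (gradient) of `f : ℝ^n → ℝ`. -/
noncomputable def pgrad {n : ℕ} (f : (Fin n → ℝ) → ℝ) (x : Fin n → ℝ) : Fin n → ℝ :=
  fun i => fderiv ℝ f x (Pi.single i 1)

lemma aux_cs (h : ℝ → ℝ) (hh : ContDiff ℝ 1 h) (x y : ℝ) (hxy : x ≤ y) :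
    (h x - h y) ^ 2 ≤ (y - x) * ∫ t in x..y, (deriv h t) ^ 2 := by
  rcases hxy.eq_or_lt with rfl | hlt
  · simp
  have hc : Continuous (deriv h) := hh.continuous_deriv le_rfl
  have hD : ∫ t in x..y, deriv h t = h y - h x := by
    apply intervalIntegral.integral_deriv_eq_sub
    · intro t _
      exact (hh.differentiable (by norm_num)) t
    · exact hc.intervalIntegrable _ _
  set D := h y - h x with hDdef
  set L := y - x with hL
  have hLpos : 0 < L := by simp [hL, hlt]
  have h0 : 0 ≤ ∫ t in x..y, (deriv h t - D / L) ^ 2 :=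
    intervalIntegral.integral_nonneg hxy (fun _ _ => sq_nonneg _)
  have h1 : ∫ t in x..y, (deriv h t - D / L) ^ 2
      = (∫ t in x..y, (deriv h t) ^ 2) - D ^ 2 / L := by
    have : ∀ t, (deriv h t - D / L) ^ 2
        = ((deriv h t) ^ 2 - (2 * (D / L)) * deriv h t) + (D / L) ^ 2 := fun t => by ring
    simp_rw [this]
    have i1 : IntervalIntegrable (fun t => (deriv h t) ^ 2) volume x y :=
      (hc.pow 2).intervalIntegrable _ _
    have i2 : IntervalIntegrable (fun t => (2 * (D / L)) * deriv h t) volume x y :=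
      (continuous_const.mul hc).intervalIntegrable _ _
    rw [intervalIntegral.integral_add (i1.sub i2) intervalIntegrable_const,
      intervalIntegral.integral_sub i1 i2, intervalIntegral.integral_const_mul, hD,
      intervalIntegral.integral_const]
    simp only [smul_eq_mul]
    rw [← hL]
    field_simp
    ring
  rw [h1] at h0
  have : D ^ 2 / L ≤ ∫ t in x..y, (deriv h t) ^ 2 := by linarith
  rw [div_le_iff₀ hLpos] at this
  have e : (h x - h y) ^ 2 = D ^ 2 := by rw [hDdef]; ring
  rw [e]; linarith

lemma aux_cs_lint (h : ℝ → ℝ) (hh : ContDiff ℝ 1 h) (x y : ℝ) (hxy : x ≤ y) :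
    ENNReal.ofReal ((h x - h y) ^ 2) ≤
      ∫⁻ t, (Ioc x y).indicator (fun t => ENNReal.ofReal (y - x) *
        ENNReal.ofReal ((deriv h t) ^ 2)) t := by
  have hc : Continuous (deriv h) := hh.continuous_deriv le_rfl
  rw [lintegral_indicator measurableSet_Ioc, lintegral_const_mul _ (by fun_prop)]
  have hi : IntegrableOn (fun t => (deriv h t) ^ 2) (Ioc x y) :=
    ((hc.pow 2).integrableOn_Icc).mono_set Ioc_subset_Icc_self
  rw [← ofReal_integral_eq_lintegral_ofReal hi
    (ae_of_all _ fun _ => sq_nonneg _), ← ENNReal.ofReal_mul (by linarith),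
    ← intervalIntegral.integral_of_le hxy]
  exact ENNReal.ofReal_le_ofReal (aux_cs h hh x y hxy)

lemma aux_tail (t : ℝ) : ∫ y in Ioi t, y ∂(gaussianReal 0 1) = gaussianPDFReal 0 1 t := by
  have hder : ∀ x ∈ Ici t, HasDerivAt (fun x => - gaussianPDFReal 0 1 x)
      (gaussianPDFReal 0 1 x * x) x := by
    intro x _
    simp only [gaussianPDFReal_def]
    have : HasDerivAt (fun x : ℝ => -(x-0)^2 / (2 * ((1 : NNReal) : ℝ))) (-x) x := by
      have := (((hasDerivAt_id x).sub_const 0).pow 2).neg.div_const (2 * ((1 : NNReal) : ℝ))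
      convert! this using 1
      simp
      ring
    have := ((this.exp).const_mul (√(2 * Real.pi * ((1 : NNReal) : ℝ)))⁻¹).neg
    convert! this using 1
    ring
  have hint : Integrable (fun x => gaussianPDFReal 0 1 x * x) := by
    have h1 : Integrable (fun x : ℝ => x) (gaussianReal 0 1) :=
      (memLp_id_gaussianReal (μ := 0) (v := 1) 1).integrable (by simp)
    rw [gaussianReal_of_var_ne_zero _ (by norm_num),
      integrable_withDensity_iff_integrable_smul' (measurable_gaussianPDF _ _)
      (ae_of_all _ fun x => by simp [gaussianPDF])] at h1
    simpa [gaussianPDF, gaussianPDFReal_nonneg] using h1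
  have htend : Filter.Tendsto (fun x => - gaussianPDFReal 0 1 x) Filter.atTop (nhds 0) := by
    rw [← neg_zero]
    apply Filter.Tendsto.neg
    simp only [gaussianPDFReal_def]
    rw [← mul_zero ((√(2 * Real.pi * ((1 : NNReal) : ℝ)))⁻¹)]
    apply Filter.Tendsto.const_mul
    apply Real.tendsto_exp_atBot.comp
    have h2 : Filter.Tendsto (fun x : ℝ => x ^ 2) Filter.atTop Filter.atTop :=
      Filter.tendsto_pow_atTop (by norm_num)
    have h3 := Filter.tendsto_neg_atTop_atBot.comp (h2.atTop_div_const (show (0 : ℝ) < 2 by norm_num))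
    refine h3.congr fun x => ?_
    simp
    ring
  have := integral_Ioi_of_hasDerivAt_of_tendsto' hder hint.integrableOn htend
  rw [zero_sub, neg_neg] at this
  rw [← this, gaussianReal_of_var_ne_zero _ (by norm_num),
    setIntegral_withDensity_eq_setIntegral_toReal_smul (measurable_gaussianPDF _ _)
    (ae_of_all _ fun x => by simp [gaussianPDF]) _ measurableSet_Ioi]
  simp [gaussianPDF, gaussianPDFReal_nonneg]

lemma aux_kernel (t : ℝ) :
    ∫⁻ x, ∫⁻ y, (Iio t).indicator (fun x => (Ici t).indicator
      (fun y => ENNReal.ofReal (y - x)) y) x ∂(gaussianReal 0 1) ∂(gaussianReal 0 1)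
    = gaussianPDF 0 1 t := by
  set μ := gaussianReal 0 1 with hμ
  have : NullSingletonClass μ := nullSingletonClass_gaussianReal (by norm_num)
  set q := μ.real (Ici t) with hq
  set p := μ.real (Iio t) with hp
  have hpq : p = 1 - q := by
    rw [hp, hq, ← compl_Ici, measureReal_compl measurableSet_Ici]
    simp
  have hid : Integrable (fun x : ℝ => x) μ :=
      (memLp_id_gaussianReal (μ := 0) (v := 1) 1).integrable (by simp)
  have hA0 : ∫ y in Ici t, y ∂μ = gaussianPDFReal 0 1 t := by
    rw [integral_Ici_eq_integral_Ioi, hμ, aux_tail]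
  have hB0 : ∫ y in Iio t, y ∂μ = - gaussianPDFReal 0 1 t := by
    have h1 := integral_add_compl (measurableSet_Ici (a := t)) hid
    rw [compl_Ici, hA0] at h1
    have h2 : ∫ y, y ∂μ = 0 := by rw [hμ]; exact integral_id_gaussianReal
    linarith
  have hA : ∫⁻ y in Ici t, ENNReal.ofReal (y - t) ∂μ
      = ENNReal.ofReal (gaussianPDFReal 0 1 t - t * q) := by
    have hi : IntegrableOn (fun y => y - t) (Ici t) μ := (hid.sub (integrable_const t)).integrableOn
    rw [← ofReal_integral_eq_lintegral_ofReal hi]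
    · congr 1
      rw [integral_sub hid.integrableOn (integrable_const t), hA0]
      simp [hq, mul_comm]
    · filter_upwards [ae_restrict_mem measurableSet_Ici] with y hy
      simpa using hy
  have hA' : 0 ≤ gaussianPDFReal 0 1 t - t * q := by
    have : gaussianPDFReal 0 1 t - t * q = ∫ y in Ici t, (y - t) ∂μ := by
      rw [integral_sub hid.integrableOn (integrable_const t), hA0]
      simp [hq, mul_comm]
    rw [this]
    exact setIntegral_nonneg measurableSet_Ici fun y hy => by simpa using hy
  have hBe : ∫ y in Iio t, (t - y) ∂μ = t * p + gaussianPDFReal 0 1 t := by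
    rw [integral_sub (integrable_const t) hid.integrableOn, hB0]
    simp [hp, mul_comm]
  have hB' : 0 ≤ t * p + gaussianPDFReal 0 1 t := by
    rw [← hBe]
    exact setIntegral_nonneg measurableSet_Iio fun y hy => by simpa using le_of_lt hy
  have hB : ∫⁻ y in Iio t, ENNReal.ofReal (t - y) ∂μ
      = ENNReal.ofReal (t * p + gaussianPDFReal 0 1 t) := by
    have hi : IntegrableOn (fun y => t - y) (Iio t) μ := ((integrable_const t).sub hid).integrableOn
    rw [← ofReal_integral_eq_lintegral_ofReal hi, hBe]
    filter_upwards [ae_restrict_mem measurableSet_Iio] with y hy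
    simpa using le_of_lt hy
  have hinner : ∀ x, ∫⁻ y, (Iio t).indicator (fun x => (Ici t).indicator
      (fun y => ENNReal.ofReal (y - x)) y) x ∂μ
      = (Iio t).indicator (fun x => ENNReal.ofReal (gaussianPDFReal 0 1 t - t * q)
          + ENNReal.ofReal (t - x) * ENNReal.ofReal q) x := by
    intro x
    by_cases hx : x ∈ Iio t
    · simp only [indicator_of_mem hx]
      rw [lintegral_indicator measurableSet_Ici, ← hA]
      have : ∫⁻ y in Ici t, ENNReal.ofReal (y - x) ∂μ
          = ∫⁻ y in Ici t, (ENNReal.ofReal (y - t) + ENNReal.ofReal (t - x)) ∂μ := by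
        apply setLIntegral_congr_fun measurableSet_Ici
        intro y hy
        have hx' : x < t := hx
        have hy' : t ≤ y := hy
        change ENNReal.ofReal (y - x) = ENNReal.ofReal (y - t) + ENNReal.ofReal (t - x)
        rw [← ENNReal.ofReal_add (by linarith) (by linarith)]
        congr 1; ring
      rw [this, lintegral_add_right _ measurable_const, lintegral_const]
      simp [hq]
    · simp [indicator_of_notMem hx]
  simp_rw [hinner]
  rw [lintegral_indicator measurableSet_Iio, lintegral_add_left measurable_const,
    lintegral_mul_const _ (by fun_prop), hB, lintegral_const]
  have hp' : (μ.restrict (Iio t)) univ = ENNReal.ofReal p := by simp [hp]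
  rw [hp', ← ENNReal.ofReal_mul hA', ← ENNReal.ofReal_mul hB', ← ENNReal.ofReal_add, gaussianPDF]
  · congr 1; rw [hpq]; ring
  · exact mul_nonneg hA' (by simp [hp])
  · exact mul_nonneg hB' (by simp [hq])

/-- Gaussian Poincaré inequality in dimension one, in two-copy form. -/
lemma poincare_one (h : ℝ → ℝ) (hh : ContDiff ℝ 1 h) :
    ∫⁻ x, ∫⁻ y, ENNReal.ofReal ((h x - h y) ^ 2) ∂(gaussianReal 0 1) ∂(gaussianReal 0 1)
      ≤ 2 * ∫⁻ t, ENNReal.ofReal ((deriv h t) ^ 2) ∂(gaussianReal 0 1) := by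
  set μ := gaussianReal 0 1 with hμ
  have hc : Continuous (deriv h) := hh.continuous_deriv le_rfl
  let A : ℝ → ℝ → ℝ → ENNReal := fun x y t =>
    (Iio t).indicator (fun x => (Ici t).indicator (fun y => ENNReal.ofReal (y - x)) y) x
      * ENNReal.ofReal ((deriv h t) ^ 2)
  have hAi : ∀ x y t, A x y t = (Ioc x y).indicator (fun t => ENNReal.ofReal (y - x) *
        ENNReal.ofReal ((deriv h t) ^ 2)) t := by
    intro x y t
    by_cases h1 : x < t <;> by_cases h2 : t ≤ y <;> simp [A, h1, h2]
  have hAm : Measurable (fun p : ℝ × ℝ × ℝ => A p.1 p.2.1 p.2.2) := by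
    simp only [hAi]
    have : (fun p : ℝ × ℝ × ℝ => (Ioc p.1 p.2.1).indicator (fun t => ENNReal.ofReal (p.2.1 - p.1) *
        ENNReal.ofReal ((deriv h t) ^ 2)) p.2.2)
        = ({p : ℝ × ℝ × ℝ | p.1 < p.2.2} ∩ {p | p.2.2 ≤ p.2.1}).indicator
          (fun p => ENNReal.ofReal (p.2.1 - p.1) * ENNReal.ofReal ((deriv h p.2.2) ^ 2)) := by
      ext p
      simp [indicator_apply]
    rw [this]
    apply Measurable.indicator
    · fun_prop
    · exact (measurableSet_lt (by fun_prop) (by fun_prop)).inter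
        (measurableSet_le (by fun_prop) (by fun_prop))
  have hle : ∀ x y, ENNReal.ofReal ((h x - h y) ^ 2) ≤ (∫⁻ t, A x y t) + ∫⁻ t, A y x t := by
    intro x y
    rcases le_total x y with hxy | hxy
    · refine le_trans ?_ le_self_add
      simp only [hAi]
      exact aux_cs_lint h hh x y hxy
    · refine le_trans ?_ le_add_self
      simp only [hAi]
      have := aux_cs_lint h hh y x hxy
      rwa [show (h x - h y) ^ 2 = (h y - h x) ^ 2 by ring]
  have m1 : Measurable (fun p : ℝ × ℝ => ∫⁻ t, A p.1 p.2 t) := by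
    apply Measurable.lintegral_prod_right' (f := fun q : (ℝ × ℝ) × ℝ => A q.1.1 q.1.2 q.2)
    exact hAm.comp (by fun_prop : Measurable (fun q : (ℝ × ℝ) × ℝ => (q.1.1, q.1.2, q.2)))
  have hval : ∫⁻ x, ∫⁻ y, (∫⁻ t, A x y t) ∂μ ∂μ = ∫⁻ t, ENNReal.ofReal ((deriv h t) ^ 2) ∂μ := by
    have s1 : ∀ x, ∫⁻ y, (∫⁻ t, A x y t) ∂μ = ∫⁻ t, ∫⁻ y, A x y t ∂μ := by
      intro x
      apply lintegral_lintegral_swap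
      exact (hAm.comp (by fun_prop : Measurable (fun q : ℝ × ℝ => (x, q.1, q.2)))).aemeasurable
    simp_rw [s1]
    rw [lintegral_lintegral_swap]
    · rw [hμ, gaussianReal_of_var_ne_zero _ (by norm_num),
        lintegral_withDensity_eq_lintegral_mul _ (measurable_gaussianPDF _ _) (by fun_prop),
        ← gaussianReal_of_var_ne_zero _ (by norm_num), ← hμ]
      apply lintegral_congr
      intro t
      rw [Pi.mul_apply, ← aux_kernel t]
      have c1 : ∀ x, ∫⁻ y, A x y t ∂μ = (∫⁻ y, (Iio t).indicator (fun x => (Ici t).indicator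
          (fun y => ENNReal.ofReal (y - x)) y) x ∂μ) * ENNReal.ofReal ((deriv h t) ^ 2) := by
        intro x
        exact lintegral_mul_const' _ _ ENNReal.ofReal_ne_top
      simp_rw [c1]
      exact lintegral_mul_const' _ _ ENNReal.ofReal_ne_top
    · refine Measurable.aemeasurable ?_
      apply Measurable.lintegral_prod_right' (f := fun q : (ℝ × ℝ) × ℝ => A q.1.1 q.2 q.1.2)
      exact hAm.comp (by fun_prop : Measurable (fun q : (ℝ × ℝ) × ℝ => (q.1.1, q.2, q.1.2)))
  calc ∫⁻ x, ∫⁻ y, ENNReal.ofReal ((h x - h y) ^ 2) ∂μ ∂μ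
      ≤ ∫⁻ x, ∫⁻ y, ((∫⁻ t, A x y t) + ∫⁻ t, A y x t) ∂μ ∂μ :=
        lintegral_mono fun x => lintegral_mono fun y => hle x y
    _ = (∫⁻ x, ∫⁻ y, (∫⁻ t, A x y t) ∂μ ∂μ) + ∫⁻ x, ∫⁻ y, (∫⁻ t, A y x t) ∂μ ∂μ := by
        rw [← lintegral_add_left]
        · apply lintegral_congr
          intro x
          rw [lintegral_add_left]
          exact m1.comp (by fun_prop : Measurable (fun y : ℝ => (x, y)))
        · exact m1.lintegral_prod_right'
    _ = _ := by
        rw [lintegral_lintegral_swap (f := fun x y => ∫⁻ t, A y x t), hval, two_mul]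
        exact (m1.comp measurable_swap).aemeasurable

/-- The standard Gaussian measure on `ℝ^n`. -/
noncomputable def gam (n : ℕ) : Measure (Fin n → ℝ) :=
  volume.withDensity fun z => ENNReal.ofReal (gaussDensity n z)

lemma gaussDensity_nonneg (n : ℕ) (x : Fin n → ℝ) : 0 ≤ gaussDensity n x := by
  unfold gaussDensity; positivity

lemma continuous_gaussDensity (n : ℕ) : Continuous (gaussDensity n) := by
  unfold gaussDensity; fun_prop

lemma measurable_gaussDensity (n : ℕ) : Measurable (gaussDensity n) :=
  (continuous_gaussDensity n).measurable

instance (n : ℕ) : SFinite (gam n) := by unfold gam; infer_instance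

lemma lintegral_gam (n : ℕ) (G : (Fin n → ℝ) → ENNReal) (hG : Measurable G) :
    ∫⁻ x, G x ∂(gam n) = ∫⁻ x, ENNReal.ofReal (gaussDensity n x) * G x := by
  rw [gam, lintegral_withDensity_eq_lintegral_mul _
    (measurable_gaussDensity n).ennreal_ofReal hG]
  rfl

lemma gaussDensity_append (k m : ℕ) (y : Fin k → ℝ) (z : Fin m → ℝ) :
    gaussDensity (k + m) (Fin.append y z) = gaussDensity k y * gaussDensity m z := by
  unfold gaussDensity
  rw [mul_mul_mul_comm, ← Real.exp_add, ← Real.rpow_add (by positivity), Fin.sum_univ_add]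
  simp only [Fin.append_left, Fin.append_right]
  push_cast
  congr 2 <;> ring

lemma continuous_append (k m : ℕ) :
    Continuous (fun p : (Fin k → ℝ) × (Fin m → ℝ) => Fin.append p.1 p.2) :=
  (Fin.appendHomeomorph k m).continuous

lemma measurePreserving_append (k m : ℕ) :
    MeasurePreserving (fun p : (Fin k → ℝ) × (Fin m → ℝ) => Fin.append p.1 p.2)
      (volume.prod volume) volume where
  measurable := (continuous_append k m).measurable
  map_eq := by
    refine (Measure.pi_eq fun s hs => ?_).symm
    rw [Measure.map_apply (continuous_append k m).measurable (MeasurableSet.univ_pi hs)]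
    have : (fun p : (Fin k → ℝ) × (Fin m → ℝ) => Fin.append p.1 p.2) ⁻¹' (univ.pi s)
        = (univ.pi fun i => s (Fin.castAdd m i)) ×ˢ (univ.pi fun i => s (Fin.natAdd k i)) := by
      ext p
      simp only [mem_preimage, mem_univ_pi, mem_prod, Fin.forall_fin_add, Fin.append_left,
        Fin.append_right]
    rw [this, Measure.prod_prod, volume_pi_pi, volume_pi_pi, Fin.prod_univ_add]

lemma lintegral_gam_append (k m : ℕ) (G : (Fin (k + m) → ℝ) → ENNReal) (hG : Measurable G) :
    ∫⁻ x, G x ∂(gam (k + m)) = ∫⁻ y, ∫⁻ z, G (Fin.append y z) ∂(gam m) ∂(gam k) := by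
  have hm := (continuous_append k m).measurable
  have hGm : Measurable (fun p : (Fin k → ℝ) × (Fin m → ℝ) => G (Fin.append p.1 p.2)) :=
    hG.comp hm
  have hd := measurable_gaussDensity (k + m)
  have hdk := measurable_gaussDensity k
  have hdm := measurable_gaussDensity m
  rw [lintegral_gam _ _ hG, ← (measurePreserving_append k m).lintegral_comp (by fun_prop),
    lintegral_prod _ (by fun_prop), lintegral_gam _ _ hGm.lintegral_prod_right']
  apply lintegral_congr
  intro y
  have hGy : Measurable (fun z => G (Fin.append y z)) := hGm.comp measurable_prodMk_left
  simp only
  rw [lintegral_gam _ _ hGy,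
    ← lintegral_const_mul' _ _ ENNReal.ofReal_ne_top]
  apply lintegral_congr
  intro z
  rw [gaussDensity_append, ENNReal.ofReal_mul (gaussDensity_nonneg _ _), mul_assoc]

lemma lintegral_gam_zero (G : (Fin 0 → ℝ) → ENNReal) : ∫⁻ x, G x ∂(gam 0) = G ![] := by
  rw [lintegral_gam _ _ (measurable_of_finite _), volume_pi, Measure.pi_of_empty _ ![],
    lintegral_dirac]
  simp [gaussDensity]

lemma lintegral_gam_one (G : (Fin 1 → ℝ) → ENNReal) (hG : Measurable G) :
    ∫⁻ x, G x ∂(gam 1) = ∫⁻ t, G (fun _ => t) ∂(gaussianReal 0 1) := by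
  have hG' : Measurable (fun t : ℝ => G (fun _ => t)) := hG.comp (by fun_prop)
  have hd := measurable_gaussDensity 1
  have hmp : MeasurePreserving (fun (t : ℝ) (_ : Fin 1) => t) volume volume := by
    refine ⟨by fun_prop, (Measure.pi_eq fun s hs => ?_).symm⟩
    rw [Measure.map_apply (by fun_prop) (MeasurableSet.univ_pi hs)]
    simp only [Finset.univ_unique, Fin.default_eq_zero, Finset.prod_singleton]
    congr 1
    ext t
    simp [Fin.forall_fin_one]
  rw [lintegral_gam _ _ hG, gaussianReal_of_var_ne_zero _ (by norm_num),
    lintegral_withDensity_eq_lintegral_mul _ (measurable_gaussianPDF _ _) hG',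
    ← hmp.lintegral_comp (by fun_prop)]
  apply lintegral_congr
  intro t
  rw [Pi.mul_apply, gaussianPDF, gaussianPDFReal, gaussDensity]
  congr 3
  · rw [Real.sqrt_eq_rpow, ← Real.rpow_neg (by positivity)]
    congr 1
    · simp
    · norm_num
  · simp

lemma gam_univ (n : ℕ) : gam n univ = 1 := by
  induction n with
  | zero => rw [← lintegral_one, lintegral_gam_zero]
  | succ n ih =>
    rw [← lintegral_one, lintegral_gam_append n 1 _ measurable_const]
    simp_rw [lintegral_gam_one _ measurable_const]
    simp [ih]

instance (n : ℕ) : IsProbabilityMeasure (gam n) := ⟨gam_univ n⟩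

/-- Two-copy variance. -/
noncomputable def PV {α : Type*} [MeasurableSpace α] (μ : Measure α) (h : α → ℝ) : ENNReal :=
  ∫⁻ x, ∫⁻ y, ENNReal.ofReal ((h x - h y) ^ 2) ∂μ ∂μ

lemma quad_aux (a a' b b' : ℝ) :
    ENNReal.ofReal ((a - b') ^ 2) + ENNReal.ofReal ((a' - b) ^ 2) ≤
    ENNReal.ofReal ((a - a') ^ 2) + ENNReal.ofReal ((b - b') ^ 2) +
      (ENNReal.ofReal ((a - b) ^ 2) + ENNReal.ofReal ((a' - b') ^ 2)) := by
  simp only [← ENNReal.ofReal_add, sq_nonneg, add_nonneg]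
  apply ENNReal.ofReal_le_ofReal
  nlinarith [sq_nonneg (a - a' - b + b')]

lemma two_fun {α : Type*} [MeasurableSpace α] (ν : Measure α) [IsProbabilityMeasure ν]
    (a b : α → ℝ) (ha : Measurable a) (hb : Measurable b) :
    2 * ∫⁻ y, ∫⁻ y', ENNReal.ofReal ((a y - b y') ^ 2) ∂ν ∂ν ≤
      PV ν a + PV ν b + 2 * ∫⁻ y, ENNReal.ofReal ((a y - b y) ^ 2) ∂ν := by
  have hsw : ∫⁻ y, ∫⁻ y', ENNReal.ofReal ((a y - b y') ^ 2) ∂ν ∂ν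
      = ∫⁻ y, ∫⁻ y', ENNReal.ofReal ((a y' - b y) ^ 2) ∂ν ∂ν := by
    rw [lintegral_lintegral_swap]
    exact Measurable.aemeasurable (by simp only [Function.uncurry_def]; fun_prop)
  have key : ∫⁻ p, (ENNReal.ofReal ((a p.1 - b p.2) ^ 2) + ENNReal.ofReal ((a p.2 - b p.1) ^ 2))
        ∂(ν.prod ν) ≤
      ∫⁻ p, (ENNReal.ofReal ((a p.1 - a p.2) ^ 2) + ENNReal.ofReal ((b p.1 - b p.2) ^ 2) +
      (ENNReal.ofReal ((a p.1 - b p.1) ^ 2) + ENNReal.ofReal ((a p.2 - b p.2) ^ 2))) ∂(ν.prod ν) :=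
    lintegral_mono fun p => quad_aux _ _ _ _
  rw [lintegral_add_left (by fun_prop), lintegral_add_left (by fun_prop),
    lintegral_add_left (by fun_prop), lintegral_add_left (by fun_prop),
    lintegral_prod _ (by fun_prop), lintegral_prod _ (by fun_prop), lintegral_prod _ (by fun_prop),
    lintegral_prod _ (by fun_prop), lintegral_prod _ (by fun_prop),
    lintegral_prod _ (by fun_prop)] at key
  simp only [lintegral_const, measure_univ, mul_one] at key
  rw [← hsw, ← two_mul, ← two_mul] at key
  exact key

lemma PV_append (k m : ℕ) (h : (Fin (k + m) → ℝ) → ℝ) (hh : Measurable h) :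
    PV (gam (k + m)) h ≤
      (∫⁻ y, PV (gam m) (fun z => h (Fin.append y z)) ∂(gam k)) +
      ∫⁻ z, PV (gam k) (fun y => h (Fin.append y z)) ∂(gam m) := by
  have hm := (continuous_append k m).measurable
  let H : (Fin k → ℝ) → (Fin m → ℝ) → ℝ := fun y z => h (Fin.append y z)
  have hH : Measurable (fun p : (Fin k → ℝ) × (Fin m → ℝ) => H p.1 p.2) := hh.comp hm
  have hHc : ∀ {γ : Type} [MeasurableSpace γ] (u : γ → (Fin k → ℝ)) (v : γ → (Fin m → ℝ)),
      Measurable u → Measurable v → Measurable (fun c => H (u c) (v c)) :=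
    fun u v hu hv => hH.comp (hu.prodMk hv)
  have hPVm : Measurable (fun y => PV (gam m) (H y)) := by
    unfold PV
    apply Measurable.lintegral_prod_right' (f := fun q : (Fin k → ℝ) × (Fin m → ℝ) =>
      ∫⁻ z', ENNReal.ofReal ((H q.1 q.2 - H q.1 z') ^ 2) ∂(gam m))
    apply Measurable.lintegral_prod_right' (f := fun q : ((Fin k → ℝ) × (Fin m → ℝ)) × (Fin m → ℝ) =>
      ENNReal.ofReal ((H q.1.1 q.1.2 - H q.1.1 q.2) ^ 2))
    exact (((hHc _ _ (by fun_prop) (by fun_prop)).sub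
      (hHc _ _ (by fun_prop) (by fun_prop))).pow_const 2).ennreal_ofReal
  have e1 : PV (gam (k + m)) h = ∫⁻ y, ∫⁻ y', ∫⁻ z, ∫⁻ z',
      ENNReal.ofReal ((H y z - H y' z') ^ 2) ∂(gam m) ∂(gam m) ∂(gam k) ∂(gam k) := by
    unfold PV
    rw [lintegral_gam_append]
    · apply lintegral_congr
      intro y
      have : ∀ z, ∫⁻ x', ENNReal.ofReal ((h (Fin.append y z) - h x') ^ 2) ∂(gam (k + m))
          = ∫⁻ y', ∫⁻ z', ENNReal.ofReal ((H y z - H y' z') ^ 2) ∂(gam m) ∂(gam k) := by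
        intro z
        rw [lintegral_gam_append _ _ _ (by fun_prop)]
      simp_rw [this]
      rw [lintegral_lintegral_swap]
      refine Measurable.aemeasurable ?_
      apply Measurable.lintegral_prod_right' (f := fun q : ((Fin m → ℝ) × (Fin k → ℝ)) × (Fin m → ℝ) =>
        ENNReal.ofReal ((H y q.1.1 - H q.1.2 q.2) ^ 2))
      exact (((hHc _ _ (by fun_prop) (by fun_prop)).sub
        (hHc _ _ (by fun_prop) (by fun_prop))).pow_const 2).ennreal_ofReal
    · apply Measurable.lintegral_prod_right' (f := fun q : (Fin (k + m) → ℝ) × (Fin (k + m) → ℝ) =>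
        ENNReal.ofReal ((h q.1 - h q.2) ^ 2))
      fun_prop
  have e2 : ∫⁻ y, ∫⁻ y', ∫⁻ z, ENNReal.ofReal ((H y z - H y' z) ^ 2) ∂(gam m) ∂(gam k) ∂(gam k)
      = ∫⁻ z, PV (gam k) (fun y => H y z) ∂(gam m) := by
    unfold PV
    have : ∀ y, ∫⁻ y', ∫⁻ z, ENNReal.ofReal ((H y z - H y' z) ^ 2) ∂(gam m) ∂(gam k)
        = ∫⁻ z, ∫⁻ y', ENNReal.ofReal ((H y z - H y' z) ^ 2) ∂(gam k) ∂(gam m) := by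
      intro y
      apply lintegral_lintegral_swap
      exact (((hHc _ _ (by fun_prop) (by fun_prop)).sub
        (hHc _ _ (by fun_prop) (by fun_prop))).pow_const 2).ennreal_ofReal.aemeasurable
    simp_rw [this]
    rw [lintegral_lintegral_swap]
    refine Measurable.aemeasurable ?_
    apply Measurable.lintegral_prod_right' (f := fun q : ((Fin k → ℝ) × (Fin m → ℝ)) × (Fin k → ℝ) =>
        ENNReal.ofReal ((H q.1.1 q.1.2 - H q.2 q.1.2) ^ 2))
    exact (((hHc _ _ (by fun_prop) (by fun_prop)).sub
        (hHc _ _ (by fun_prop) (by fun_prop))).pow_const 2).ennreal_ofReal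
  have key : 2 * PV (gam (k + m)) h ≤ 2 * ((∫⁻ y, PV (gam m) (H y) ∂(gam k)) +
      ∫⁻ z, PV (gam k) (fun y => H y z) ∂(gam m)) := by
    calc 2 * PV (gam (k + m)) h
        = ∫⁻ y, ∫⁻ y', 2 * ∫⁻ z, ∫⁻ z',
      ENNReal.ofReal ((H y z - H y' z') ^ 2) ∂(gam m) ∂(gam m) ∂(gam k) ∂(gam k) := by
          rw [e1, ← lintegral_const_mul' _ _ (by norm_num)]
          apply lintegral_congr
          intro y
          rw [← lintegral_const_mul' _ _ (by norm_num)]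
      _ ≤ ∫⁻ y, ∫⁻ y', (PV (gam m) (H y) + PV (gam m) (H y') +
            2 * ∫⁻ z, ENNReal.ofReal ((H y z - H y' z) ^ 2) ∂(gam m)) ∂(gam k) ∂(gam k) := by
          refine lintegral_mono fun y => lintegral_mono fun y' => ?_
          exact two_fun _ _ _ (hHc _ _ (by fun_prop) (by fun_prop))
            (hHc _ _ (by fun_prop) (by fun_prop))
      _ = _ := by
          have : ∀ y, ∫⁻ y', (PV (gam m) (H y) + PV (gam m) (H y') +
            2 * ∫⁻ z, ENNReal.ofReal ((H y z - H y' z) ^ 2) ∂(gam m)) ∂(gam k)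
            = (PV (gam m) (H y) + ∫⁻ y', PV (gam m) (H y') ∂(gam k)) +
              2 * ∫⁻ y', ∫⁻ z, ENNReal.ofReal ((H y z - H y' z) ^ 2) ∂(gam m) ∂(gam k) := by
            intro y
            rw [lintegral_add_left (by fun_prop), lintegral_add_left (by fun_prop),
              lintegral_const_mul' _ _ (by norm_num)]
            simp
          simp_rw [this]
          rw [lintegral_add_left (by fun_prop), lintegral_add_left (by fun_prop),
              lintegral_const_mul' _ _ (by norm_num), e2]
          simp
          ring
  exact (ENNReal.mul_le_mul_iff_right (by norm_num) (by norm_num)).1 key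

lemma contDiff_append_right {k m : ℕ} (y : Fin k → ℝ) :
    ContDiff ℝ 1 (fun z : Fin m → ℝ => Fin.append y z) := by
  rw [contDiff_pi]
  intro i
  refine Fin.addCases (fun i => ?_) (fun i => ?_) i
  · simp only [Fin.append_left]; fun_prop
  · simp only [Fin.append_right]; fun_prop

lemma contDiff_append_left {k m : ℕ} (z : Fin m → ℝ) :
    ContDiff ℝ 1 (fun y : Fin k → ℝ => Fin.append y z) := by
  rw [contDiff_pi]
  intro i
  refine Fin.addCases (fun i => ?_) (fun i => ?_) i
  · simp only [Fin.append_left]; fun_prop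
  · simp only [Fin.append_right]; fun_prop

/-- The partial derivative is the derivative along the coordinate line. -/
lemma pgrad_comp {n m : ℕ} (h : (Fin n → ℝ) → ℝ) (hh : ContDiff ℝ 1 h)
    (u : (Fin m → ℝ) → (Fin n → ℝ)) (hu : ContDiff ℝ 1 u) (z : Fin m → ℝ) (i : Fin m)
    (v : Fin n → ℝ) (hv : ∀ t : ℝ, u (z + t • Pi.single i 1) = u z + t • v) :
    pgrad (fun z => h (u z)) z i = fderiv ℝ h (u z) v := by
  have hd : DifferentiableAt ℝ h (u z) := hh.differentiable (by norm_num) _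
  have hdu : DifferentiableAt ℝ u z := hu.differentiable (by norm_num) _
  unfold pgrad
  have : fderiv ℝ (fun z => h (u z)) z = (fderiv ℝ h (u z)).comp (fderiv ℝ u z) :=
    fderiv_comp z hd hdu
  rw [this, ContinuousLinearMap.comp_apply]
  congr 1
  have h1 : lineDeriv ℝ u z (Pi.single i 1) = fderiv ℝ u z (Pi.single i 1) :=
    hdu.lineDeriv_eq_fderiv
  rw [← h1, lineDeriv]
  simp_rw [hv]
  have : HasDerivAt (fun t : ℝ => u z + t • v) v 0 := by
    simpa using ((hasDerivAt_id (0 : ℝ)).smul_const v).const_add (u z)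
  exact this.deriv

lemma continuous_pgrad {n : ℕ} (h : (Fin n → ℝ) → ℝ) (hh : ContDiff ℝ 1 h) (i : Fin n) :
    Continuous (fun x => pgrad h x i) := by
  unfold pgrad
  exact (hh.continuous_fderiv (by norm_num)).clm_apply continuous_const

lemma pgrad_append_right {k m : ℕ} (h : (Fin (k + m) → ℝ) → ℝ) (hh : ContDiff ℝ 1 h)
    (y : Fin k → ℝ) (z : Fin m → ℝ) (i : Fin m) :
    pgrad (fun z => h (Fin.append y z)) z i = pgrad h (Fin.append y z) (Fin.natAdd k i) := by
  apply pgrad_comp h hh _ (contDiff_append_right y)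
  intro t
  ext j
  refine Fin.addCases (fun j => ?_) (fun j => ?_) j
  · simp [Pi.single_apply]
    intro h; exact absurd (congrArg Fin.val h) (by simp; omega)
  · simp [Pi.single_apply]

lemma pgrad_append_left {k m : ℕ} (h : (Fin (k + m) → ℝ) → ℝ) (hh : ContDiff ℝ 1 h)
    (y : Fin k → ℝ) (z : Fin m → ℝ) (i : Fin k) :
    pgrad (fun y => h (Fin.append y z)) y i = pgrad h (Fin.append y z) (Fin.castAdd m i) := by
  apply pgrad_comp h hh _ (contDiff_append_left z)
  intro t
  ext j
  refine Fin.addCases (fun j => ?_) (fun j => ?_) j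
  · simp [Pi.single_apply]
  · simp [Pi.single_apply]
    intro h; exact absurd (congrArg Fin.val h) (by simp; omega)

/-- Gaussian Poincaré inequality. -/
def Poin (n : ℕ) : Prop := ∀ h : (Fin n → ℝ) → ℝ, ContDiff ℝ 1 h →
  PV (gam n) h ≤ 2 * ∫⁻ x, ∑ i, ENNReal.ofReal ((pgrad h x i) ^ 2) ∂(gam n)

lemma poin_zero : Poin 0 := by
  intro h hh
  unfold PV
  simp [lintegral_gam_zero]

lemma poin_one : Poin 1 := by
  intro h hh
  have hc := hh.continuous.measurable
  have h1 : ContDiff ℝ 1 (fun t : ℝ => h (fun _ => t)) := hh.comp (by fun_prop)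
  have := poincare_one _ h1
  have e : PV (gam 1) h = ∫⁻ x, ∫⁻ y, ENNReal.ofReal ((h (fun _ => x) - h (fun _ => y)) ^ 2)
      ∂(gaussianReal 0 1) ∂(gaussianReal 0 1) := by
    unfold PV
    rw [lintegral_gam_one]
    · apply lintegral_congr
      intro x
      rw [lintegral_gam_one _ (by fun_prop)]
    · apply Measurable.lintegral_prod_right' (f := fun q : (Fin 1 → ℝ) × (Fin 1 → ℝ) =>
        ENNReal.ofReal ((h q.1 - h q.2) ^ 2))
      fun_prop
  rw [e]
  refine this.trans (le_of_eq ?_)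
  have hg := (continuous_pgrad h hh 0).measurable
  simp only [Finset.univ_unique, Fin.default_eq_zero, Finset.sum_singleton]
  rw [lintegral_gam_one _ (by fun_prop)]
  congr 1
  apply lintegral_congr
  intro t
  congr 2
  have hd : HasFDerivAt h (fderiv ℝ h (fun _ => t)) (fun _ => t) :=
    (hh.differentiable (by norm_num) _).hasFDerivAt
  have hl : HasDerivAt (fun (t : ℝ) (_ : Fin 1) => t) (fun _ => 1) t :=
    hasDerivAt_pi.2 fun _ => hasDerivAt_id t
  have := hd.comp_hasDerivAt t hl
  rw [show (fun t : ℝ => h (fun _ => t)) = h ∘ (fun (t : ℝ) (_ : Fin 1) => t) from rfl, this.deriv,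
    pgrad]
  congr 1
  ext i
  fin_cases i
  simp

lemma aux_fub {α β : Type*} [MeasurableSpace α] [MeasurableSpace β] (μ : Measure α) (ν : Measure β)
    [SFinite μ] [SFinite ν] (F G : α → β → ENNReal) (hF : Measurable (fun p : α × β => F p.1 p.2))
    (hG : Measurable (fun p : α × β => G p.1 p.2)) :
    (∫⁻ y, ∫⁻ z, F y z ∂ν ∂μ) + ∫⁻ z, ∫⁻ y, G y z ∂μ ∂ν = ∫⁻ y, ∫⁻ z, (G y z + F y z) ∂ν ∂μ := by
  have e : ∫⁻ z, ∫⁻ y, G y z ∂μ ∂ν = ∫⁻ y, ∫⁻ z, G y z ∂ν ∂μ :=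
    (lintegral_lintegral_swap hG.aemeasurable).symm
  rw [e, add_comm, ← lintegral_add_left hG.lintegral_prod_right']
  apply lintegral_congr
  intro y
  have : Measurable (G y) := hG.comp measurable_prodMk_left
  rw [lintegral_add_left this]

lemma poin_add (k m : ℕ) (hk : Poin k) (hm : Poin m) : Poin (k + m) := by
  intro h hh
  have hc := hh.continuous.measurable
  have hg := fun i => (continuous_pgrad h hh i).measurable
  have ha := (continuous_append k m).measurable
  refine (PV_append k m h hc).trans ?_
  have hF : Measurable (fun p : (Fin k → ℝ) × (Fin m → ℝ) => ∑ i : Fin m,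
      ENNReal.ofReal ((pgrad h (Fin.append p.1 p.2) (Fin.natAdd k i)) ^ 2)) :=
    Finset.measurable_fun_sum _ fun i _ => ((((hg _).comp ha).pow_const 2).ennreal_ofReal)
  have hG : Measurable (fun p : (Fin k → ℝ) × (Fin m → ℝ) => ∑ i : Fin k,
      ENNReal.ofReal ((pgrad h (Fin.append p.1 p.2) (Fin.castAdd m i)) ^ 2)) :=
    Finset.measurable_fun_sum _ fun i _ => ((((hg _).comp ha).pow_const 2).ennreal_ofReal)
  have h1 : ∫⁻ y, PV (gam m) (fun z => h (Fin.append y z)) ∂(gam k) ≤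
      ∫⁻ y, 2 * ∫⁻ z, ∑ i : Fin m, ENNReal.ofReal ((pgrad h (Fin.append y z) (Fin.natAdd k i)) ^ 2)
        ∂(gam m) ∂(gam k) := by
    refine lintegral_mono fun y => ?_
    have hcd : ContDiff ℝ 1 (fun z => h (Fin.append y z)) := hh.comp (contDiff_append_right y)
    refine (hm _ hcd).trans (le_of_eq ?_)
    simp_rw [pgrad_append_right h hh]
  have h2 : ∫⁻ z, PV (gam k) (fun y => h (Fin.append y z)) ∂(gam m) ≤
      ∫⁻ z, 2 * ∫⁻ y, ∑ i : Fin k, ENNReal.ofReal ((pgrad h (Fin.append y z) (Fin.castAdd m i)) ^ 2)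
        ∂(gam k) ∂(gam m) := by
    refine lintegral_mono fun z => ?_
    have hcd : ContDiff ℝ 1 (fun y => h (Fin.append y z)) := hh.comp (contDiff_append_left z)
    refine (hk _ hcd).trans (le_of_eq ?_)
    simp_rw [pgrad_append_left h hh]
  refine (add_le_add h1 h2).trans (le_of_eq ?_)
  rw [lintegral_const_mul' _ _ (by norm_num), lintegral_const_mul' _ _ (by norm_num), ← mul_add]
  congr 1
  rw [lintegral_gam_append _ _ _ (by fun_prop)]
  simp_rw [Fin.sum_univ_add]
  exact aux_fub (gam k) (gam m) _ _ hF hG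

lemma poincare (n : ℕ) : Poin n := by
  induction n with
  | zero => exact poin_zero
  | succ n ih => exact poin_add n 1 ih poin_one

lemma gaussDensity_rot (n : ℕ) (W : Matrix (Fin n) (Fin n) ℝ) (hW : Wᵀ * W = 1) (x : Fin n → ℝ) :
    gaussDensity n (W *ᵥ x) = gaussDensity n x := by
  unfold gaussDensity
  have : ∑ i, (W *ᵥ x) i ^ 2 = ∑ i, x i ^ 2 := by
    have h1 : (W *ᵥ x) ⬝ᵥ (W *ᵥ x) = x ⬝ᵥ x := by
      rw [dotProduct_mulVec, vecMul_mulVec, hW, vecMul_one]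
    simpa [dotProduct, sq] using h1
  rw [this]

lemma lintegral_gam_rot (n : ℕ) (W : Matrix (Fin n) (Fin n) ℝ) (hW : Wᵀ * W = 1)
    (G : (Fin n → ℝ) → ENNReal) (hG : Measurable G) :
    ∫⁻ x, G x ∂(gam n) = ∫⁻ x, G (W *ᵥ x) ∂(gam n) := by
  have hd := measurable_gaussDensity n
  have hWc : Continuous (fun x : Fin n → ℝ => W *ᵥ x) := by fun_prop
  have hdet2 : W.det * W.det = 1 := by
    have := congrArg Matrix.det hW
    simpa using this
  have hdet : W.det ≠ 0 := by
    intro h; rw [h] at hdet2; simp at hdet2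
  have habs : |W.det⁻¹| = 1 := by
    rw [abs_inv]
    have : |W.det| = 1 := by
      have h3 : |W.det| * |W.det| = 1 := by rw [← abs_mul, hdet2, abs_one]
      nlinarith [abs_nonneg W.det]
    simp [this]
  have hmap := Real.map_matrix_volume_pi_eq_smul_volume_pi hdet
  rw [habs] at hmap
  have hmp : MeasurePreserving (fun x : Fin n → ℝ => W *ᵥ x) volume volume := by
    refine ⟨hWc.measurable, ?_⟩
    have e : (fun x : Fin n → ℝ => W *ᵥ x) = toLin' W := by ext x; simp
    rw [e, hmap]; simp
  have hGW : Measurable (fun x => G (W *ᵥ x)) := hG.comp hWc.measurable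
  rw [lintegral_gam _ _ hG, lintegral_gam _ _ hGW,
    ← hmp.lintegral_comp (by fun_prop)]
  simp_rw [gaussDensity_rot n W hW]

lemma mulVec_append (k m : ℕ) (W : Matrix (Fin (k + m)) (Fin (k + m)) ℝ)
    (y : Fin k → ℝ) (z : Fin m → ℝ) :
    W *ᵥ (Fin.append y z) = W.submatrix id (Fin.castAdd m) *ᵥ y +
      W.submatrix id (Fin.natAdd k) *ᵥ z := by
  ext i
  simp [mulVec, dotProduct, Fin.sum_univ_add]

lemma lintegral_gam_split (k m : ℕ) (W : Matrix (Fin (k + m)) (Fin (k + m)) ℝ) (hW : Wᵀ * W = 1)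
    (G : (Fin (k + m) → ℝ) → ENNReal) (hG : Measurable G) :
    ∫⁻ x, G x ∂(gam (k + m)) = ∫⁻ y, ∫⁻ z, G (W.submatrix id (Fin.castAdd m) *ᵥ y +
      W.submatrix id (Fin.natAdd k) *ᵥ z) ∂(gam m) ∂(gam k) := by
  have hWc : Continuous (fun x : Fin (k + m) → ℝ => W *ᵥ x) := by fun_prop
  have hGW : Measurable (fun x => G (W *ᵥ x)) := hG.comp hWc.measurable
  rw [lintegral_gam_rot _ W hW G hG, lintegral_gam_append _ _ _ hGW]
  simp_rw [mulVec_append]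

lemma proj_split (k m : ℕ) (W : Matrix (Fin (k + m)) (Fin (k + m)) ℝ) (hW : Wᵀ * W = 1)
    (y : Fin k → ℝ) (z : Fin m → ℝ) :
    (W.submatrix id (Fin.castAdd m))ᵀ *ᵥ (W.submatrix id (Fin.castAdd m) *ᵥ y +
      W.submatrix id (Fin.natAdd k) *ᵥ z) = y := by
  rw [← mulVec_append]
  have h1 : Wᵀ *ᵥ (W *ᵥ (Fin.append y z)) = Fin.append y z := by
    rw [mulVec_mulVec, hW, one_mulVec]
  ext i
  have := congrFun h1 (Fin.castAdd m i)
  rw [Fin.append_left] at this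
  exact this

lemma two_evariance {α : Type*} [MeasurableSpace α] (μ : Measure α) [IsProbabilityMeasure μ]
    (h : α → ℝ) (hm : Measurable h) (hL : MemLp h 2 μ) : PV μ h = 2 * evariance h μ := by
  set E := ∫ x, h x ∂μ with hE
  have hi : Integrable h μ := hL.integrable (by norm_num)
  have hi0 : Integrable (fun y => h y - E) μ := hi.sub (integrable_const E)
  have hi2 : Integrable (fun y => (h y - E) ^ 2) μ :=
    (hL.sub (memLp_const E)).integrable_sq
  have hz : ∫ y, (h y - E) ∂μ = 0 := by
    rw [integral_sub hi (integrable_const E)]; simp [hE]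
  have hx : ∀ x, ∫⁻ y, ENNReal.ofReal ((h x - h y) ^ 2) ∂μ
      = ENNReal.ofReal ((h x - E) ^ 2) + evariance h μ := by
    intro x
    have e : ∀ y, (h x - h y) ^ 2 = ((h x - E) ^ 2 - 2 * (h x - E) * (h y - E)) + (h y - E) ^ 2 :=
      fun y => by ring
    have i1 : Integrable (fun y => (h x - E) ^ 2 - 2 * (h x - E) * (h y - E)) μ :=
      (integrable_const _).sub (hi0.const_mul _)
    have hint : Integrable (fun y => (h x - h y) ^ 2) μ := by
      simp_rw [e]; exact i1.add hi2
    rw [← ofReal_integral_eq_lintegral_ofReal hint (ae_of_all _ fun _ => sq_nonneg _)]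
    simp_rw [e]
    rw [integral_add i1 hi2, integral_sub (integrable_const _) (hi0.const_mul _),
      integral_const_mul, hz, evariance_eq_lintegral_ofReal,
      ← ofReal_integral_eq_lintegral_ofReal hi2 (ae_of_all _ fun _ => sq_nonneg _),
      ← ENNReal.ofReal_add (sq_nonneg _) (integral_nonneg fun _ => sq_nonneg _)]
    simp
  unfold PV
  simp_rw [hx]
  rw [lintegral_add_left (by fun_prop), lintegral_const, measure_univ, mul_one,
    ← evariance_eq_lintegral_ofReal, two_mul]

lemma memLp_of_PV {α : Type*} [MeasurableSpace α] (μ : Measure α) [IsProbabilityMeasure μ]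
    (h : α → ℝ) (hm : Measurable h) (hL : PV μ h ≠ ⊤) : MemLp h 2 μ := by
  have hmeas : Measurable (fun x => ∫⁻ y, ENNReal.ofReal ((h x - h y) ^ 2) ∂μ) := by
    apply Measurable.lintegral_prod_right' (f := fun q : α × α =>
      ENNReal.ofReal ((h q.1 - h q.2) ^ 2))
    fun_prop
  obtain ⟨x, hx⟩ := (ae_lt_top hmeas hL).exists
  have hint : Integrable (fun y => (h x - h y) ^ 2) μ :=
    (lintegral_ofReal_ne_top_iff_integrable (by fun_prop) (ae_of_all _ fun _ => sq_nonneg _)).1 hx.ne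
  have h2 : MemLp (fun y => h x - h y) 2 μ :=
    (memLp_two_iff_integrable_sq (by fun_prop)).2 hint
  have := (memLp_const (h x)).sub h2
  convert! this using 1
  ext y
  simp

lemma mc_bound {m N : ℕ} (hN : 1 ≤ N) {Ω : Type*} [MeasurableSpace Ω] (P : Measure Ω)
    [IsProbabilityMeasure P] (Z : Fin N → Ω → (Fin m → ℝ)) (hZ : ∀ j, Measurable (Z j))
    (hlaw : ∀ j, Measure.map (Z j) P = gam m) (hind : iIndepFun Z P)
    (h : (Fin m → ℝ) → ℝ) (hh : ContDiff ℝ 1 h) :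
    ∫⁻ ω, ENNReal.ofReal (((∫ z, h z ∂(gam m)) - (N : ℝ)⁻¹ * ∑ j, h (Z j ω)) ^ 2) ∂P ≤
      (N : ENNReal)⁻¹ * ∫⁻ z, ∑ i, ENNReal.ofReal ((pgrad h z i) ^ 2) ∂(gam m) := by
  have hm : Measurable h := hh.continuous.measurable
  have hNpos : (0 : ℝ) < N := by exact_mod_cast hN
  set D := ∫⁻ z, ∑ i, ENNReal.ofReal ((pgrad h z i) ^ 2) ∂(gam m) with hD
  by_cases hDt : D = ⊤
  · rw [hDt, ENNReal.mul_top (by simp)]; exact le_top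
  have hPV := poincare m h hh
  rw [← hD] at hPV
  have hL : MemLp h 2 (gam m) :=
    memLp_of_PV _ h hm (ne_top_of_le_ne_top (ENNReal.mul_ne_top (by norm_num) hDt) hPV)
  rw [two_evariance _ h hm hL] at hPV
  have hv : evariance h (gam m) ≤ D :=
    (ENNReal.mul_le_mul_iff_right (by norm_num) (by norm_num)).1 hPV
  let X : Fin N → Ω → ℝ := fun j ω => h (Z j ω)
  have hX : ∀ j, MemLp (X j) 2 P := fun j => by
    have : MemLp h 2 (Measure.map (Z j) P) := by rw [hlaw]; exact hL
    exact this.comp_of_map (hZ j).aemeasurable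
  have hXvar : ∀ j, variance (X j) P = variance h (gam m) := fun j => by
    rw [← hlaw j, variance_map hm.aemeasurable (hZ j).aemeasurable]; rfl
  have hXE : ∀ j, ∫ ω, X j ω ∂P = ∫ z, h z ∂(gam m) := fun j => by
    rw [← hlaw j, integral_map (hZ j).aemeasurable hm.aestronglyMeasurable]
  have hXind : iIndepFun X P := hind.comp (fun _ => h) (fun _ => hm)
  have hvs : variance (∑ j, X j) P = N * variance h (gam m) := by
    rw [IndepFun.variance_sum (fun j _ => hX j) (fun i _ j _ hij => hXind.indepFun hij)]
    simp [hXvar]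
  let S : Ω → ℝ := fun ω => (N : ℝ)⁻¹ * (∑ j, X j) ω
  have hS : MemLp S 2 P := (memLp_finsetSum' _ fun j _ => hX j).const_mul _
  have hSE : ∫ ω, S ω ∂P = ∫ z, h z ∂(gam m) := by
    simp only [S, Finset.sum_apply]
    rw [integral_const_mul, integral_finsetSum _ fun j _ => (hX j).integrable (by norm_num)]
    simp only [hXE]
    simp
    field_simp
  have hSvar : variance S P = (N : ℝ)⁻¹ * variance h (gam m) := by
    simp only [S]
    rw [variance_const_mul, hvs]
    field_simp
  have e : ∫⁻ ω, ENNReal.ofReal (((∫ z, h z ∂(gam m)) - (N : ℝ)⁻¹ * ∑ j, h (Z j ω)) ^ 2) ∂P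
      = evariance S P := by
    rw [evariance_eq_lintegral_ofReal, hSE]
    apply lintegral_congr
    intro ω
    congr 1
    simp only [S, X, Finset.sum_apply]
    ring
  rw [e, ← hS.ofReal_variance_eq, hSvar, ENNReal.ofReal_mul (by positivity),
    hL.ofReal_variance_eq, ENNReal.ofReal_inv_of_pos hNpos, ENNReal.ofReal_natCast]
  gcongr

lemma grad_sum {n : ℕ} (f : (Fin n → ℝ) → ℝ) (x v : Fin n → ℝ) :
    fderiv ℝ f x v = ∑ l, v l * pgrad f x l := by
  unfold pgrad
  conv_lhs => rw [pi_eq_sum_univ' v]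
  simp [map_sum]

lemma integral_dir {n : ℕ} (f : (Fin n → ℝ) → ℝ) (hf : ContDiff ℝ 1 f)
    (hsq : ∀ i, Integrable fun x => (pgrad f x i) ^ 2 * gaussDensity n x)
    (W : Matrix (Fin n) (Fin n) ℝ) (hW : Wᵀ * W = 1) (Λ : Fin n → ℝ)
    (hC : (Matrix.of fun i j => ∫ x, pgrad f x i * pgrad f x j * gaussDensity n x) =
      W * Matrix.diagonal Λ * Wᵀ) (i : Fin n) :
    ∫⁻ x, ENNReal.ofReal ((∑ l, W l i * pgrad f x l) ^ 2) ∂(gam n) = ENNReal.ofReal (Λ i) := by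
  have hg := fun i => continuous_pgrad f hf i
  have hd := continuous_gaussDensity n
  have hint : ∀ l l', Integrable (fun x => pgrad f x l * pgrad f x l' * gaussDensity n x) := by
    intro l l'
    refine ((hsq l).add (hsq l')).mono' (by fun_prop) (ae_of_all _ fun x => ?_)
    have h0 := gaussDensity_nonneg n x
    rw [Real.norm_eq_abs, abs_mul, abs_of_nonneg h0, Pi.add_apply, ← add_mul]
    apply mul_le_mul_of_nonneg_right _ h0
    rw [abs_le]
    constructor <;> nlinarith [sq_nonneg (pgrad f x l + pgrad f x l'),
      sq_nonneg (pgrad f x l - pgrad f x l')]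
  have e : ∀ x, gaussDensity n x * (∑ l, W l i * pgrad f x l) ^ 2
      = ∑ l, ∑ l', W l i * W l' i * (pgrad f x l * pgrad f x l' * gaussDensity n x) := by
    intro x
    rw [sq, Finset.sum_mul_sum, Finset.mul_sum]
    refine Finset.sum_congr rfl fun l _ => ?_
    rw [Finset.mul_sum]
    refine Finset.sum_congr rfl fun l' _ => ?_
    ring
  have hI : Integrable (fun x => gaussDensity n x * (∑ l, W l i * pgrad f x l) ^ 2) := by
    simp_rw [e]
    exact integrable_finsetSum _ fun l _ => integrable_finsetSum _ fun l' _ =>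
      (hint l l').const_mul _
  have hval : ∫ x, gaussDensity n x * (∑ l, W l i * pgrad f x l) ^ 2 = Λ i := by
    simp_rw [e]
    rw [integral_finsetSum _ fun l _ => integrable_finsetSum _ fun l' _ =>
      (hint l l').const_mul _]
    have : ∀ l, ∫ x, ∑ l', W l i * W l' i * (pgrad f x l * pgrad f x l' * gaussDensity n x)
        = ∑ l', W l i * W l' i * (W * Matrix.diagonal Λ * Wᵀ) l l' := by
      intro l
      rw [integral_finsetSum _ fun l' _ => (hint l l').const_mul _]
      refine Finset.sum_congr rfl fun l' _ => ?_
      rw [integral_const_mul, ← hC]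
      rfl
    simp_rw [this]
    have h2 : (Wᵀ * (W * Matrix.diagonal Λ * Wᵀ) * W) i i = Λ i := by
      rw [show Wᵀ * (W * Matrix.diagonal Λ * Wᵀ) * W = (Wᵀ * W) * Matrix.diagonal Λ * (Wᵀ * W) by
        simp only [Matrix.mul_assoc], hW]
      simp
    rw [← h2, Matrix.mul_apply]
    simp_rw [Matrix.mul_apply (M := Wᵀ), Finset.sum_mul]
    rw [Finset.sum_comm]
    refine Finset.sum_congr rfl fun l _ => Finset.sum_congr rfl fun l' _ => ?_
    rw [Matrix.transpose_apply]
    ring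
  rw [lintegral_gam _ _ (by fun_prop)]
  simp_rw [← ENNReal.ofReal_mul (gaussDensity_nonneg n _)]
  rw [← ofReal_integral_eq_lintegral_ofReal hI
    (ae_of_all _ fun x => mul_nonneg (gaussDensity_nonneg n x) (sq_nonneg _)), hval]

lemma integral_gam (n : ℕ) (h : (Fin n → ℝ) → ℝ) :
    ∫ z, h z ∂(gam n) = ∫ z, h z * gaussDensity n z := by
  rw [gam, integral_withDensity_eq_integral_toReal_smul
    (measurable_gaussDensity n).ennreal_ofReal (ae_of_all _ fun _ => ENNReal.ofReal_lt_top)]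
  simp [gaussDensity_nonneg, mul_comm]

/-- Monte Carlo error bound in the Gaussian case: with
`C = ∫ ∇f ∇fᵀ ρX dx = W Λ Wᵀ`, `g` the conditional expectation over the inactive variable,
`f_g(x) = g(W₁ᵀx)`, and `g_N` the `N`-sample Monte Carlo approximation with i.i.d. samples of
density `φ_m` jointly measurable in `(y,ω)`, one has
`E[∫ (f_g(x) - f_{g_N}(x,·))² ρX(x) dx] ≤ (1/N)(λ_{k+1} + ⋯ + λ_{k+m})`. -/
theorem monte_carlo_mse_bound
    (k m : ℕ)
    (f : (Fin (k + m) → ℝ) → ℝ)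
    (hf : ContDiff ℝ 1 f)
    (hsq : ∀ i, Integrable fun x => (pgrad f x i) ^ 2 * gaussDensity (k + m) x)
    (W : Matrix (Fin (k + m)) (Fin (k + m)) ℝ)
    (hW : Wᵀ * W = 1)
    (Λ : Fin (k + m) → ℝ)
    (hΛdesc : ∀ i j, i ≤ j → Λ j ≤ Λ i)
    (hΛnonneg : ∀ i, 0 ≤ Λ i)
    (hC : (Matrix.of fun i j => ∫ x, pgrad f x i * pgrad f x j * gaussDensity (k + m) x) =
      W * Matrix.diagonal Λ * Wᵀ)
    (g : (Fin k → ℝ) → ℝ)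
    (hg : ∀ y, g y = ∫ z, f (W.submatrix id (Fin.castAdd m) *ᵥ y +
      W.submatrix id (Fin.natAdd k) *ᵥ z) * gaussDensity m z)
    (Ω : Type*) [MeasurableSpace Ω] (P : Measure Ω) [IsProbabilityMeasure P]
    (N : ℕ) (hN : 1 ≤ N)
    (Z : Fin N → (Fin k → ℝ) → Ω → (Fin m → ℝ))
    (hZmeas : ∀ j, Measurable fun p : (Fin k → ℝ) × Ω => Z j p.1 p.2)
    (hZlaw : ∀ j y, Measure.map (Z j y) P =
      volume.withDensity fun z => ENNReal.ofReal (gaussDensity m z))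
    (hZindep : ∀ y, iIndepFun (fun j => Z j y) P)
    (gN : (Fin k → ℝ) → Ω → ℝ)
    (hgN : ∀ y ω, gN y ω = (N : ℝ)⁻¹ * ∑ j, f (W.submatrix id (Fin.castAdd m) *ᵥ y +
      W.submatrix id (Fin.natAdd k) *ᵥ Z j y ω)) :
    ∫ ω, (∫ x, (g ((W.submatrix id (Fin.castAdd m))ᵀ *ᵥ x) -
        gN ((W.submatrix id (Fin.castAdd m))ᵀ *ᵥ x) ω) ^ 2 * gaussDensity (k + m) x) ∂P ≤
      (1 / N : ℝ) * ∑ j : Fin m, Λ (Fin.natAdd k j) := by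
  set W₁ := W.submatrix id (Fin.castAdd m) with hW₁
  set W₂ := W.submatrix id (Fin.natAdd k) with hW₂
  have hd := measurable_gaussDensity (k + m)
  have hdm := measurable_gaussDensity m
  have hfm : Measurable f := hf.continuous.measurable
  have hgrad := fun i => (continuous_pgrad f hf i).measurable
  have hNpos : (0 : ℝ) < N := by exact_mod_cast hN
  -- measurability
  have hgm : Measurable g := by
    have : StronglyMeasurable (fun y => ∫ z, f (W₁ *ᵥ y + W₂ *ᵥ z) * gaussDensity m z) := by
      apply StronglyMeasurable.integral_prod_right'
        (f := fun p : (Fin k → ℝ) × (Fin m → ℝ) => f (W₁ *ᵥ p.1 + W₂ *ᵥ p.2) * gaussDensity m p.2)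
      apply Continuous.stronglyMeasurable
      have := hf.continuous
      have := continuous_gaussDensity m
      fun_prop
    rw [show g = _ from funext hg]
    exact this.measurable
  have hgNm : Measurable (fun p : (Fin k → ℝ) × Ω => gN p.1 p.2) := by
    simp_rw [hgN]
    refine Measurable.const_mul (Finset.measurable_fun_sum _ fun j _ => hfm.comp ?_) _
    have c1 : Measurable (fun y : Fin k → ℝ => W₁ *ᵥ y) :=
      (by fun_prop : Continuous (fun y : Fin k → ℝ => W₁ *ᵥ y)).measurable
    have c2 : Measurable (fun y : Fin m → ℝ => W₂ *ᵥ y) :=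
      (by fun_prop : Continuous (fun y : Fin m → ℝ => W₂ *ᵥ y)).measurable
    exact (c1.comp measurable_fst).add (c2.comp (hZmeas j))
  have hEm : Measurable (fun p : (Fin k → ℝ) × Ω =>
      ENNReal.ofReal ((g p.1 - gN p.1 p.2) ^ 2)) :=
    (((hgm.comp measurable_fst).sub hgNm).pow_const 2).ennreal_ofReal
  have hWT : Measurable (fun x : Fin (k + m) → ℝ => W₁ᵀ *ᵥ x) :=
    (by fun_prop : Continuous (fun x : Fin (k + m) → ℝ => W₁ᵀ *ᵥ x)).measurable
  -- inner integral
  have hinner : ∀ ω, ‖∫ x, (g (W₁ᵀ *ᵥ x) - gN (W₁ᵀ *ᵥ x) ω) ^ 2 * gaussDensity (k + m) x‖ₑ ≤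
      ∫⁻ y, ENNReal.ofReal ((g y - gN y ω) ^ 2) ∂(gam k) := by
    intro ω
    have hEω : Measurable (fun y => ENNReal.ofReal ((g y - gN y ω) ^ 2)) :=
      hEm.comp measurable_prodMk_right
    have hEx : Measurable (fun x => ENNReal.ofReal ((g (W₁ᵀ *ᵥ x) - gN (W₁ᵀ *ᵥ x) ω) ^ 2)) :=
      hEω.comp hWT
    refine (enorm_integral_le_lintegral_enorm _).trans (le_of_eq ?_)
    have : ∀ x, ‖(g (W₁ᵀ *ᵥ x) - gN (W₁ᵀ *ᵥ x) ω) ^ 2 * gaussDensity (k + m) x‖ₑ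
        = ENNReal.ofReal (gaussDensity (k + m) x) *
          ENNReal.ofReal ((g (W₁ᵀ *ᵥ x) - gN (W₁ᵀ *ᵥ x) ω) ^ 2) := by
      intro x
      rw [Real.enorm_eq_ofReal (mul_nonneg (sq_nonneg _) (gaussDensity_nonneg _ _)), mul_comm,
        ENNReal.ofReal_mul (gaussDensity_nonneg _ _)]
    simp_rw [this]
    rw [← lintegral_gam _ _ hEx, lintegral_gam_split k m W hW _ hEx]
    simp_rw [hW₁, proj_split k m W hW]
    simp
  -- Monte Carlo
  have hmc : ∀ y, ∫⁻ ω, ENNReal.ofReal ((g y - gN y ω) ^ 2) ∂P ≤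
      (N : ENNReal)⁻¹ * ∫⁻ z, ∑ i : Fin m, ENNReal.ofReal
        ((∑ l, W l (Fin.natAdd k i) * pgrad f (W₁ *ᵥ y + W₂ *ᵥ z) l) ^ 2) ∂(gam m) := by
    intro y
    have hu : ContDiff ℝ 1 (fun z : Fin m → ℝ => W₁ *ᵥ y + W₂ *ᵥ z) := by
      apply ContDiff.add contDiff_const
      exact (LinearMap.toContinuousLinearMap (Matrix.toLin' W₂)).contDiff
    have hh : ContDiff ℝ 1 (fun z : Fin m → ℝ => f (W₁ *ᵥ y + W₂ *ᵥ z)) := hf.comp hu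
    have hb := mc_bound hN P (fun j => Z j y) (fun j => (hZmeas j).comp measurable_prodMk_left)
      (fun j => hZlaw j y) (hZindep y) _ hh
    simp_rw [hg, hgN, ← integral_gam m]
    refine hb.trans (le_of_eq ?_)
    congr 1
    refine lintegral_congr fun z => Finset.sum_congr rfl fun i _ => ?_
    congr 2
    rw [pgrad_comp f hf _ hu z i (fun l => W l (Fin.natAdd k i)), grad_sum]
    intro t
    rw [Matrix.mulVec_add, Matrix.mulVec_smul, add_assoc]
    congr 3
    ext l
    simp [hW₂]
  have hfin : ‖∫ ω, (∫ x, (g (W₁ᵀ *ᵥ x) - gN (W₁ᵀ *ᵥ x) ω) ^ 2 * gaussDensity (k + m) x) ∂P‖ₑ ≤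
      ENNReal.ofReal ((1 / N : ℝ) * ∑ j : Fin m, Λ (Fin.natAdd k j)) := by
    calc _ ≤ ∫⁻ ω, ‖∫ x, (g (W₁ᵀ *ᵥ x) - gN (W₁ᵀ *ᵥ x) ω) ^ 2 * gaussDensity (k + m) x‖ₑ ∂P :=
          enorm_integral_le_lintegral_enorm _
      _ ≤ ∫⁻ ω, ∫⁻ y, ENNReal.ofReal ((g y - gN y ω) ^ 2) ∂(gam k) ∂P := lintegral_mono hinner
      _ = ∫⁻ y, ∫⁻ ω, ENNReal.ofReal ((g y - gN y ω) ^ 2) ∂P ∂(gam k) :=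
          (lintegral_lintegral_swap hEm.aemeasurable).symm
      _ ≤ ∫⁻ y, (N : ENNReal)⁻¹ * ∫⁻ z, ∑ i : Fin m, ENNReal.ofReal
        ((∑ l, W l (Fin.natAdd k i) * pgrad f (W₁ *ᵥ y + W₂ *ᵥ z) l) ^ 2) ∂(gam m) ∂(gam k) :=
          lintegral_mono hmc
      _ = (N : ENNReal)⁻¹ * ∫⁻ x, ∑ i : Fin m, ENNReal.ofReal
        ((∑ l, W l (Fin.natAdd k i) * pgrad f x l) ^ 2) ∂(gam (k + m)) := by
          rw [lintegral_const_mul' _ _ (by simp; omega),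
            lintegral_gam_split k m W hW (fun x => ∑ i : Fin m, ENNReal.ofReal
              ((∑ l, W l (Fin.natAdd k i) * pgrad f x l) ^ 2)) (by fun_prop)]
      _ = _ := by
          rw [lintegral_finsetSum _ fun i _ => by fun_prop]
          simp_rw [integral_dir f hf hsq W hW Λ hC]
          rw [← ENNReal.ofReal_sum_of_nonneg fun i _ => hΛnonneg _,
            ENNReal.ofReal_mul (by positivity), one_div, ENNReal.ofReal_inv_of_pos hNpos,
            ENNReal.ofReal_natCast]
  rw [Real.enorm_eq_ofReal_abs, ENNReal.ofReal_le_ofReal_iff] at hfin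
  · exact (le_abs_self _).trans hfin
  · exact mul_nonneg (by positivity) (Finset.sum_nonneg fun _ _ => hΛnonneg _)
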